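/- arXiv:0911.4165 — 7 statements merged into one kernel-verified Lean document; each statement's English description precedes it below -/
import Mathlib

section
/- Let μ > 0, β > 0 and a ≥ 2/μ². Then for every α > 0, ∫₀^∞ exp(−α·μ·t − α²·t/2)·f_{a,β}(t) dt = (1 + a·(μ·α + α²/2))^{−β}, and this function of α is completely monotone on (0,∞); equivalently, it is the restriction to (0,∞) of the Laplace transform of a Borel probability measure on [0,∞). -/
open MeasureTheory Real Set

/-- The Gamma density with scale `a` and shape `β`: `f_{a,β}(t) = t^{β−1} e^{−t/a}/(Γ(β) a^β)`. -/
noncomputable def gammaDensity (a β t : ℝ) : ℝ :=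
  t ^ (β - 1) * Real.exp (-t / a) / (Real.Gamma β * a ^ β)

/-- A function `r` is completely monotone on `(0,∞)` if it is infinitely differentiable there
and `(−1)^n r^{(n)}(α) ≥ 0` for every `n ≥ 0` and every `α > 0`. -/
def CompletelyMonotoneOn (r : ℝ → ℝ) : Prop :=
  ContDiffOn ℝ ((⊤ : ℕ∞) : WithTop ℕ∞) r (Ioi 0) ∧
    ∀ n : ℕ, ∀ α ∈ Ioi (0 : ℝ), 0 ≤ (-1 : ℝ) ^ n * iteratedDerivWithin n r (Ioi 0) α

/-- The Laplace transform of a probability measure on `[0,∞)` is completely monotone. -/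
theorem completelyMonotoneOn_of_eq_laplace {q : Measure ℝ} [IsProbabilityMeasure q]
    (hq : q (Iio 0) = 0) {r : ℝ → ℝ}
    (hr : ∀ α > (0 : ℝ), ∫ x, Real.exp (-α * x) ∂q = r α) :
    CompletelyMonotoneOn r := by
  have hnn : ∀ᵐ x ∂q, 0 ≤ x := by
    rw [ae_iff]
    simpa [Iio] using hq
  have hsub : Ioi (0 : ℝ) ⊆
      interior (ProbabilityTheory.integrableExpSet (fun x : ℝ => -x) q) := by
    refine interior_maximal (fun α (hα : 0 < α) => ?_) isOpen_Ioi
    refine Integrable.of_bound (C := 1) (by fun_prop) ?_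
    filter_upwards [hnn] with x hx
    rw [Real.norm_eq_abs, Real.abs_exp, Real.exp_le_one_iff]
    nlinarith
  have heq : EqOn r (ProbabilityTheory.mgf (fun x : ℝ => -x) q) (Ioi 0) := fun α hα => by
    rw [← hr α hα, ProbabilityTheory.mgf]
    simp
  refine ⟨?_, fun n α hα => ?_⟩
  · exact ((ProbabilityTheory.analyticOnNhd_mgf.mono hsub).contDiffOn
      isOpen_Ioi.uniqueDiffOn).congr heq
  · rw [iteratedDerivWithin_congr heq hα, iteratedDerivWithin_of_isOpen isOpen_Ioi hα,
      ProbabilityTheory.iteratedDeriv_mgf (hsub hα), ← integral_const_mul]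
    refine integral_nonneg_of_ae ?_
    filter_upwards [hnn] with x hx
    rw [← mul_assoc, ← mul_pow, neg_one_mul, neg_neg]
    positivity

/-- The Gamma measure of shape `β` and rate `s` has Laplace transform `(1 + α/s)^{−β}`. -/
theorem integral_exp_neg_mul_gammaMeasure {β s α : ℝ} (hβ : 0 < β) (hs : 0 < s) (hα : 0 ≤ α) :
    ∫ x, Real.exp (-α * x) ∂(ProbabilityTheory.gammaMeasure β s) = (1 + α / s) ^ (-β) := by
  have hΓ := (Real.Gamma_pos_of_pos hβ).ne'
  have hsβ := (rpow_pos_of_pos hs β).ne'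
  have hsα : 0 < s + α := by positivity
  rw [ProbabilityTheory.gammaMeasure, integral_withDensity_eq_integral_toReal_smul
    (f := ProbabilityTheory.gammaPDF β s)
    (ProbabilityTheory.measurable_gammaPDFReal β s).ennreal_ofReal
    (Filter.Eventually.of_forall fun _ => ENNReal.ofReal_lt_top)]
  calc
    _ = ∫ x, (Ici (0 : ℝ)).indicator (fun x =>
          s ^ β / Real.Gamma β * (x ^ (β - 1) * Real.exp (-((s + α) * x)))) x := by
      refine integral_congr_ae (Filter.Eventually.of_forall fun x => ?_)
      beta_reduce
      rw [ProbabilityTheory.gammaPDF,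
        ENNReal.toReal_ofReal (ProbabilityTheory.gammaPDFReal_nonneg hβ hs x)]
      simp only [ProbabilityTheory.gammaPDFReal, indicator, mem_Ici, smul_eq_mul, ite_mul,
        zero_mul]
      split_ifs
      · rw [show -((s + α) * x) = -(s * x) + -α * x by ring, Real.exp_add]
        ring
      · rfl
    _ = s ^ β * (1 / (s + α)) ^ β := by
      rw [integral_indicator measurableSet_Ici, integral_Ici_eq_integral_Ioi, integral_const_mul,
        integral_rpow_mul_exp_neg_mul_Ioi hβ hsα]
      field_simp
    _ = _ := by
      rw [← mul_rpow hs.le (by positivity), rpow_neg (by positivity), ← inv_rpow (by positivity)]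
      congr 1
      field_simp

theorem gammaMeasure_Iio_zero (β s : ℝ) :
    ProbabilityTheory.gammaMeasure β s (Iio 0) = 0 := by
  rw [ProbabilityTheory.gammaMeasure, withDensity_apply _ measurableSet_Iio,
    ProbabilityTheory.lintegral_gammaPDF_of_nonpos le_rfl]

/-- The convolution of two probability measures on `[0,∞)` is a probability measure on `[0,∞)`
whose Laplace transform is the product of the two Laplace transforms. -/
theorem exists_isProbabilityMeasure_laplace_mul (p q : Measure ℝ) [IsProbabilityMeasure p]
    [IsProbabilityMeasure q] (hp : p (Iio 0) = 0) (hq : q (Iio 0) = 0) :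
    ∃ m : Measure ℝ, IsProbabilityMeasure m ∧ m (Iio 0) = 0 ∧ ∀ α : ℝ,
      ∫ x, Real.exp (-α * x) ∂m =
        (∫ x, Real.exp (-α * x) ∂p) * ∫ x, Real.exp (-α * x) ∂q := by
  have hmeas : Measurable fun z : ℝ × ℝ => z.1 + z.2 := by fun_prop
  refine ⟨(p.prod q).map fun z => z.1 + z.2,
    Measure.isProbabilityMeasure_map hmeas.aemeasurable, ?_, fun α => ?_⟩
  · rw [Measure.map_apply hmeas measurableSet_Iio]
    refine measure_mono_null (t := Iio 0 ×ˢ univ ∪ univ ×ˢ Iio 0) ?_ ?_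
    · rintro ⟨x, y⟩ h
      by_contra! hc
      simp at h hc
      linarith
    · rw [measure_union_null_iff, Measure.prod_prod, Measure.prod_prod, hp, hq]
      simp
  · rw [integral_map hmeas.aemeasurable (by fun_prop), ← integral_prod_mul]
    simp only [mul_add, Real.exp_add]

/-- The boundary transform of the Gamma density, as a Laplace transform at `c = αμ + α²/2`. -/
theorem integral_exp_neg_mul_gammaDensity {a β c : ℝ} (ha : 0 < a) (hβ : 0 < β) (hc : 0 ≤ c) :
    ∫ t in Ioi (0 : ℝ), Real.exp (-c * t) * gammaDensity a β t = (1 + a * c) ^ (-β) := by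
  have hΓ := (Real.Gamma_pos_of_pos hβ).ne'
  have haβ := (rpow_pos_of_pos ha β).ne'
  have hac : 0 < 1 / a + c := by positivity
  calc
    _ = ∫ t in Ioi (0 : ℝ), (Real.Gamma β * a ^ β)⁻¹ *
          (t ^ (β - 1) * Real.exp (-((1 / a + c) * t))) := by
      congr 1 with t
      rw [gammaDensity, show -((1 / a + c) * t) = -t / a + -c * t by ring, Real.exp_add]
      ring
    _ = (a ^ β)⁻¹ * (1 / (1 / a + c)) ^ β := by
      rw [integral_const_mul, integral_rpow_mul_exp_neg_mul_Ioi hβ hac]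
      field_simp
    _ = _ := by
      rw [← inv_rpow ha.le, ← mul_rpow (by positivity) (by positivity),
        rpow_neg (by positivity), ← inv_rpow (by positivity)]
      congr 1
      field_simp

/-- If `a ≥ 2/μ²`, then `1 + a(μα + α²/2)` has two negative real roots. -/
theorem exists_pos_factorization {μ a : ℝ} (hμ : 0 < μ) (ha : 2 / μ ^ 2 ≤ a) :
    ∃ u v : ℝ, 0 < u ∧ 0 < v ∧
      ∀ α : ℝ, 1 + a * (μ * α + α ^ 2 / 2) = (1 + α / u) * (1 + α / v) := by
  have ha0 : 0 < a := lt_of_lt_of_le (by positivity) ha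
  have h2 : 2 ≤ a * μ ^ 2 := (div_le_iff₀ (by positivity)).1 ha
  have hD : 0 ≤ μ ^ 2 - 2 / a := by
    rw [sub_nonneg, div_le_iff₀ ha0]
    linarith
  have hsq := Real.sq_sqrt hD
  have hlt : √(μ ^ 2 - 2 / a) < μ := by
    rw [Real.sqrt_lt' hμ]
    have : 0 < 2 / a := by positivity
    linarith
  set d := √(μ ^ 2 - 2 / a)
  have hd : 0 ≤ d := Real.sqrt_nonneg _
  have hu : 0 < μ - d := sub_pos.2 hlt
  have hv : 0 < μ + d := by positivity
  refine ⟨μ - d, μ + d, hu, hv, fun α => ?_⟩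
  have hprod : a * ((μ - d) * (μ + d)) = 2 := by
    have : (μ - d) * (μ + d) = 2 / a := by linear_combination -hsq
    rw [this]
    field_simp
  field_simp
  linear_combination (2 * μ * α + α ^ 2) * hprod

/-- **Existence for the linear boundary with Gamma target.** For `μ > 0`, `β > 0` and
`a ≥ 2/μ²`, the boundary transform of the Gamma density equals
`(1 + a(μα + α²/2))^{−β}`, which is completely monotone on `(0,∞)`; equivalently it is
the Laplace transform of a Borel probability measure on `[0,∞)`. -/
theorem gamma_linear_boundary_completely_monotone
    (μ β a : ℝ) (hμ : 0 < μ) (hβ : 0 < β) (ha : 2 / μ ^ 2 ≤ a) :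
    (∀ α > (0 : ℝ),
      ∫ t in Ioi (0 : ℝ), Real.exp (-α * μ * t - α ^ 2 * t / 2) * gammaDensity a β t
        = (1 + a * (μ * α + α ^ 2 / 2)) ^ (-β)) ∧
    CompletelyMonotoneOn (fun α => (1 + a * (μ * α + α ^ 2 / 2)) ^ (-β)) ∧
    ∃ q : Measure ℝ, IsProbabilityMeasure q ∧ q (Iio 0) = 0 ∧
      ∀ α > (0 : ℝ), ∫ x, Real.exp (-α * x) ∂q = (1 + a * (μ * α + α ^ 2 / 2)) ^ (-β) := by
  have ha0 : 0 < a := lt_of_lt_of_le (by positivity) ha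
  obtain ⟨u, v, hu, hv, huv⟩ := exists_pos_factorization hμ ha
  have := ProbabilityTheory.isProbabilityMeasure_gammaMeasure hβ hu
  have := ProbabilityTheory.isProbabilityMeasure_gammaMeasure hβ hv
  obtain ⟨q, hq, hq0, hqL⟩ := exists_isProbabilityMeasure_laplace_mul
    (ProbabilityTheory.gammaMeasure β u) (ProbabilityTheory.gammaMeasure β v)
    (gammaMeasure_Iio_zero β u) (gammaMeasure_Iio_zero β v)
  have hL : ∀ α > (0 : ℝ),
      ∫ x, Real.exp (-α * x) ∂q = (1 + a * (μ * α + α ^ 2 / 2)) ^ (-β) := fun α hα => by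
    have hα' : 0 ≤ α := le_of_lt hα
    rw [hqL, integral_exp_neg_mul_gammaMeasure hβ hu hα',
      integral_exp_neg_mul_gammaMeasure hβ hv hα', huv, mul_rpow (by positivity) (by positivity)]
  refine ⟨fun α hα => ?_, completelyMonotoneOn_of_eq_laplace hq0 hL, q, hq, hq0, hL⟩
  rw [← integral_exp_neg_mul_gammaDensity ha0 hβ (c := μ * α + α ^ 2 / 2) (by positivity)]
  congr 1 with t
  ring_nf
end

section
/- Let μ > 0, β > 0 and a ≥ 2/μ², and set c⁺ := (a/2)·(μ + √(μ² − 2/a)) and c⁻ := (a/2)·(μ − √(μ² − 2/a)) (both positive). Then for every α > 0: ∫₀^∞ exp(−t·(α·μ + α²/2))·f_{a,β}(t) dt = (1 + c⁺·α)^{−β}·(1 + c⁻·α)^{−β} = ∫₀^∞ e^{−αx}·(f_{c⁺,β} ⋆ f_{c⁻,β})(x) dx. -/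
open MeasureTheory Real Set

/-- The convolution of two functions on `[0,∞)`: `(h₁ ⋆ h₂)(x) = ∫₀^x h₁(u) h₂(x−u) du`. -/
noncomputable def posConv (h₁ h₂ : ℝ → ℝ) (x : ℝ) : ℝ :=
  ∫ u in Ioo (0 : ℝ) x, h₁ u * h₂ (x - u)

/-- The exponentially tilted Gamma density has the shape of a Gamma integrand. -/
theorem exp_mul_gammaDensity (a β s t : ℝ) :
    Real.exp (-s * t) * gammaDensity a β t
      = t ^ (β - 1) * Real.exp (-((s + 1 / a) * t)) / (Real.Gamma β * a ^ β) := by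
  have h : Real.exp (-((s + 1 / a) * t)) = Real.exp (-s * t) * Real.exp (-t / a) := by
    rw [← Real.exp_add]
    ring_nf
  rw [gammaDensity, h]
  ring

theorem integrableOn_exp_mul_gammaDensity {a β s : ℝ} (ha : 0 < a) (hβ : 0 < β) (hs : 0 ≤ s) :
    IntegrableOn (fun t => Real.exp (-s * t) * gammaDensity a β t) (Ioi 0) := by
  have hr : 0 < s + 1 / a := by positivity
  have h := integrableOn_rpow_mul_exp_neg_mul_rpow (s := β - 1) (p := 1) (by linarith) zero_lt_one hr
  simp only [exp_mul_gammaDensity]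
  refine Integrable.div_const ?_ _
  simpa only [Real.rpow_one, neg_mul, IntegrableOn] using h

/-- The Laplace transform of the Gamma density. -/
theorem integral_exp_mul_gammaDensity {a β s : ℝ} (ha : 0 < a) (hβ : 0 < β) (hs : 0 ≤ s) :
    ∫ t in Ioi (0 : ℝ), Real.exp (-s * t) * gammaDensity a β t = (1 + a * s) ^ (-β) := by
  have hr : 0 < s + 1 / a := by positivity
  have hΓ := (Real.Gamma_pos_of_pos hβ).ne'
  have h1 : 0 < 1 + a * s := by positivity
  have h2 : 1 / (s + 1 / a) = a / (1 + a * s) := by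
    field_simp
    ring
  simp only [exp_mul_gammaDensity]
  rw [integral_div, Real.integral_rpow_mul_exp_neg_mul_Ioi hβ hr, h2,
    Real.div_rpow ha.le h1.le, Real.rpow_neg h1.le]
  have := (Real.rpow_pos_of_pos ha β).ne'
  field_simp

/-- The Laplace transform turns convolution on the half-line into multiplication. -/
theorem integral_exp_mul_posConv {f g : ℝ → ℝ} {s : ℝ}
    (hf : IntegrableOn (fun t => Real.exp (-s * t) * f t) (Ioi 0))
    (hg : IntegrableOn (fun t => Real.exp (-s * t) * g t) (Ioi 0)) :
    ∫ x in Ioi (0 : ℝ), Real.exp (-s * x) * posConv f g x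
      = (∫ t in Ioi (0 : ℝ), Real.exp (-s * t) * f t)
        * ∫ t in Ioi (0 : ℝ), Real.exp (-s * t) * g t := by
  have h := integral_posConvolution (μ := volume) (ν := volume) hf hg
    (ContinuousLinearMap.mul ℝ ℝ)
  simp only [ContinuousLinearMap.mul_apply'] at h
  rw [← h]
  refine setIntegral_congr_fun measurableSet_Ioi fun x hx => ?_
  simp only [posConv]
  rw [← integral_const_mul, intervalIntegral.integral_of_le (le_of_lt hx),
    integral_Ioc_eq_integral_Ioo]
  refine setIntegral_congr_fun measurableSet_Ioo fun u _ => ?_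
  have he : Real.exp (-s * x) = Real.exp (-s * u) * Real.exp (-s * (x - u)) := by
    rw [← Real.exp_add]
    ring_nf
  simp only [he]
  ring

/-- **Gamma factorization for the linear boundary.** For `μ > 0`, `β > 0`, `a ≥ 2/μ²`, with
`c± = (a/2)(μ ± √(μ²−2/a))` both positive, the boundary transform of the Gamma density
factorizes as a product of two Gamma Laplace transforms, i.e. the Laplace transform of a
convolution of Gamma densities. -/
theorem gamma_linear_boundary_factorization
    (μ β a : ℝ) (hμ : 0 < μ) (hβ : 0 < β) (ha : 2 / μ ^ 2 ≤ a)
    (cp cm : ℝ)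
    (hcp : cp = a / 2 * (μ + Real.sqrt (μ ^ 2 - 2 / a)))
    (hcm : cm = a / 2 * (μ - Real.sqrt (μ ^ 2 - 2 / a))) :
    0 < cp ∧ 0 < cm ∧
    ∀ α > (0 : ℝ),
      (∫ t in Ioi (0 : ℝ), Real.exp (-t * (α * μ + α ^ 2 / 2)) * gammaDensity a β t
          = (1 + cp * α) ^ (-β) * (1 + cm * α) ^ (-β)) ∧
      (1 + cp * α) ^ (-β) * (1 + cm * α) ^ (-β)
        = ∫ x in Ioi (0 : ℝ),
            Real.exp (-α * x) * posConv (gammaDensity cp β) (gammaDensity cm β) x := by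
  have ha0 : 0 < a := lt_of_lt_of_le (by positivity) ha
  have hd : 0 ≤ μ ^ 2 - 2 / a := by
    rw [sub_nonneg, div_le_iff₀ ha0]
    rw [div_le_iff₀ (by positivity)] at ha
    linarith
  have hsq := Real.sq_sqrt hd
  have hlt : Real.sqrt (μ ^ 2 - 2 / a) < μ := by
    rw [Real.sqrt_lt' hμ]
    have : 0 < 2 / a := by positivity
    linarith
  have hp : 0 < cp := by
    have := Real.sqrt_nonneg (μ ^ 2 - 2 / a)
    rw [hcp]
    positivity
  have hm : 0 < cm := by
    rw [hcm]
    exact mul_pos (by positivity) (sub_pos.2 hlt)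
  have hsum : cp + cm = a * μ := by
    rw [hcp, hcm]
    ring
  have hprod : cp * cm = a / 2 := by
    calc cp * cm = a ^ 2 / 4 * (μ ^ 2 - Real.sqrt (μ ^ 2 - 2 / a) ^ 2) := by
          rw [hcp, hcm]
          ring
      _ = a / 2 := by
          rw [hsq]
          field_simp
          ring
  refine ⟨hp, hm, fun α hα => ⟨?_, ?_⟩⟩
  · have hs : 0 ≤ α * μ + α ^ 2 / 2 := by positivity
    rw [← Real.mul_rpow (by positivity) (by positivity),
      show (1 + cp * α) * (1 + cm * α) = 1 + a * (α * μ + α ^ 2 / 2) by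
        linear_combination α * hsum + α ^ 2 * hprod,
      ← integral_exp_mul_gammaDensity ha0 hβ hs]
    simp only [neg_mul, mul_comm (_ + _) _]
  · rw [integral_exp_mul_posConv (integrableOn_exp_mul_gammaDensity hp hβ hα.le)
        (integrableOn_exp_mul_gammaDensity hm hβ hα.le),
      integral_exp_mul_gammaDensity hp hβ hα.le, integral_exp_mul_gammaDensity hm hβ hα.le]
end

section
/- Let μ > 0 and let (p_n)_{n≥1}, (a_n)_{n≥1}, (b_n)_{n≥1} be sequences with p_n ≥ 0, Σ_{n≥1} p_n = 1, b_n > 0 and a_n ≥ 2/μ² for every n. Set f(t) := Σ_{n≥1} p_n·f_{a_n,b_n}(t) for t > 0, and, with c_n^± := (a_n/2)·(μ ± √(μ² − 2/a_n)), set g(x) := Σ_{n≥1} p_n·(f_{c_n^+,b_n} ⋆ f_{c_n^−,b_n})(x) for x > 0. Then g is a probability density on (0,∞), and for every α > 0: ∫₀^∞ e^{−αx}·g(x) dx = ∫₀^∞ exp(−t·(α·μ + α²/2))·f(t) dt. -/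
open MeasureTheory Real Set

lemma measurable_gammaDensity (c b : ℝ) : Measurable (gammaDensity c b) := by
  unfold gammaDensity
  fun_prop

lemma gammaDensity_nonneg {c b t : ℝ} (hc : 0 < c) (hb : 0 < b) (ht : 0 ≤ t) :
    0 ≤ gammaDensity c b t := by
  unfold gammaDensity
  positivity

lemma integral_exp_mul_gammaDensity_s8 {c b s : ℝ} (hc : 0 < c) (hb : 0 < b) (hs : 0 ≤ s) :
    ∫ x in Ioi (0 : ℝ), exp (-(s * x)) * gammaDensity c b x = ((1 + s * c) ^ b)⁻¹ := by
  have hr : 0 < s + 1 / c := by positivity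
  have hfun (x : ℝ) : exp (-(s * x)) * gammaDensity c b x
      = (Gamma b * c ^ b)⁻¹ * (x ^ (b - 1) * exp (-((s + 1 / c) * x))) := by
    rw [gammaDensity, show -((s + 1 / c) * x) = -(s * x) + -x / c by ring, exp_add]
    ring
  have hΓ : Gamma b ≠ 0 := (Gamma_pos_of_pos hb).ne'
  have hcb : c ^ b ≠ 0 := (rpow_pos_of_pos hc b).ne'
  simp_rw [hfun]
  rw [integral_const_mul, integral_rpow_mul_exp_neg_mul_Ioi hb hr,
    show 1 / (s + 1 / c) = c / (1 + s * c) by field_simp; ring,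
    div_rpow hc.le (by positivity)]
  field_simp

lemma integrableOn_exp_mul_gammaDensity_s8 {c b s : ℝ} (hc : 0 < c) (hb : 0 < b) (hs : 0 ≤ s) :
    IntegrableOn (fun x ↦ exp (-(s * x)) * gammaDensity c b x) (Ioi 0) :=
  .of_integral_ne_zero (by rw [integral_exp_mul_gammaDensity_s8 hc hb hs]; positivity)

lemma measurable_posConv {h₁ h₂ : ℝ → ℝ} (hh₁ : Measurable h₁) (hh₂ : Measurable h₂) :
    Measurable (posConv h₁ h₂) := by
  have hset : MeasurableSet {q : ℝ × ℝ | q.2 ∈ Ioo 0 q.1} :=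
    (measurableSet_lt measurable_const measurable_snd).inter
      (measurableSet_lt measurable_snd measurable_fst)
  have hmeas : Measurable fun q : ℝ × ℝ ↦ h₁ q.2 * h₂ (q.1 - q.2) := by fun_prop
  convert! (hmeas.indicator hset).stronglyMeasurable.integral_prod_right'
    (ν := volume) |>.measurable using 2 with x
  rw [posConv, ← integral_indicator measurableSet_Ioo]
  rfl

lemma posConv_nonneg {h₁ h₂ : ℝ → ℝ} (hh₁ : ∀ t, 0 ≤ t → 0 ≤ h₁ t)
    (hh₂ : ∀ t, 0 ≤ t → 0 ≤ h₂ t) (x : ℝ) : 0 ≤ posConv h₁ h₂ x :=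
  setIntegral_nonneg measurableSet_Ioo fun u hu ↦
    mul_nonneg (hh₁ u hu.1.le) (hh₂ (x - u) (sub_nonneg.2 hu.2.le))

lemma exp_mul_posConv (s : ℝ) (h₁ h₂ : ℝ → ℝ) (x : ℝ) :
    exp (-(s * x)) * posConv h₁ h₂ x
      = posConv (fun u ↦ exp (-(s * u)) * h₁ u) (fun u ↦ exp (-(s * u)) * h₂ u) x := by
  rw [posConv, posConv, ← integral_const_mul]
  congr 1 with u
  rw [show -(s * x) = -(s * u) + -(s * (x - u)) by ring, exp_add]
  ring

lemma posConv_eq_intervalIntegral (h₁ h₂ : ℝ → ℝ) {x : ℝ} (hx : 0 < x) :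
    posConv h₁ h₂ x = ∫ u in (0 : ℝ)..x, ContinuousLinearMap.mul ℝ ℝ (h₁ u) (h₂ (x - u)) := by
  rw [intervalIntegral.integral_of_le hx.le, integral_Ioc_eq_integral_Ioo]
  rfl

lemma integrableOn_posConv {h₁ h₂ : ℝ → ℝ} (hh₁ : IntegrableOn h₁ (Ioi 0))
    (hh₂ : IntegrableOn h₂ (Ioi 0)) : IntegrableOn (posConv h₁ h₂) (Ioi 0) := by
  refine (integrable_posConvolution hh₁ hh₂
    (ContinuousLinearMap.mul ℝ ℝ)).integrableOn.congr_fun (fun x hx ↦ ?_) measurableSet_Ioi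
  rw [posConv_eq_intervalIntegral h₁ h₂ hx, posConvolution, indicator_of_mem hx]

lemma integral_posConv {h₁ h₂ : ℝ → ℝ} (hh₁ : IntegrableOn h₁ (Ioi 0))
    (hh₂ : IntegrableOn h₂ (Ioi 0)) :
    ∫ x in Ioi (0 : ℝ), posConv h₁ h₂ x
      = (∫ x in Ioi (0 : ℝ), h₁ x) * ∫ x in Ioi (0 : ℝ), h₂ x := by
  rw [setIntegral_congr_fun measurableSet_Ioi
    fun x hx ↦ posConv_eq_intervalIntegral h₁ h₂ hx]
  exact integral_posConvolution hh₁ hh₂ (ContinuousLinearMap.mul ℝ ℝ)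

lemma integrableOn_exp_mul_posConv_gammaDensity {c d b s : ℝ} (hc : 0 < c) (hd : 0 < d)
    (hb : 0 < b) (hs : 0 ≤ s) :
    IntegrableOn (fun x ↦ exp (-(s * x)) * posConv (gammaDensity c b) (gammaDensity d b) x)
      (Ioi 0) := by
  simp_rw [exp_mul_posConv]
  exact integrableOn_posConv (integrableOn_exp_mul_gammaDensity_s8 hc hb hs)
    (integrableOn_exp_mul_gammaDensity_s8 hd hb hs)

lemma integral_exp_mul_posConv_gammaDensity {c d b s : ℝ} (hc : 0 < c) (hd : 0 < d)
    (hb : 0 < b) (hs : 0 ≤ s) :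
    ∫ x in Ioi (0 : ℝ), exp (-(s * x)) * posConv (gammaDensity c b) (gammaDensity d b) x
      = (((1 + s * c) * (1 + s * d)) ^ b)⁻¹ := by
  simp_rw [exp_mul_posConv]
  rw [integral_posConv (integrableOn_exp_mul_gammaDensity_s8 hc hb hs)
      (integrableOn_exp_mul_gammaDensity_s8 hd hb hs), integral_exp_mul_gammaDensity_s8 hc hb hs,
    integral_exp_mul_gammaDensity_s8 hd hb hs, mul_rpow (by positivity) (by positivity), mul_inv]

lemma Measurable.tsum_of_nonneg {F : ℕ → ℝ → ℝ} (hF : ∀ n, Measurable (F n))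
    (hF_nonneg : ∀ n x, 0 ≤ F n x) : Measurable fun x ↦ ∑' n, F n x := by
  have hfun : (fun x ↦ ∑' n, F n x) = fun x ↦ ((∑' n, (F n x).toNNReal : NNReal) : ℝ) := by
    ext x
    simp [NNReal.coe_tsum, Real.coe_toNNReal _ (hF_nonneg _ x)]
  rw [hfun]
  simp_rw [NNReal.tsum_eq_toNNReal_tsum]
  fun_prop

/-- The weighted integral of a mixture of nonnegative functions is the mixture of their weighted
integrals, as soon as the latter are bounded by `1`. -/
lemma integral_exp_mul_tsum {s : ℝ} {p m : ℕ → ℝ} {F : ℕ → ℝ → ℝ} (hp : ∀ n, 0 ≤ p n)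
    (hp_sum : Summable p) (hF_nonneg : ∀ n, ∀ x ∈ Ioi (0 : ℝ), 0 ≤ F n x)
    (hF : ∀ n, IntegrableOn (fun x ↦ exp (-(s * x)) * F n x) (Ioi 0))
    (hF_integral : ∀ n, ∫ x in Ioi (0 : ℝ), exp (-(s * x)) * F n x = m n)
    (hm : ∀ n, m n ≤ 1) :
    ∫ x in Ioi (0 : ℝ), exp (-(s * x)) * ∑' n, p n * F n x = ∑' n, p n * m n := by
  have hm_nonneg (n : ℕ) : 0 ≤ m n := by
    rw [← hF_integral n]
    exact setIntegral_nonneg measurableSet_Ioi fun x hx ↦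
      mul_nonneg (exp_nonneg _) (hF_nonneg n x hx)
  have hint (n : ℕ) : ∫ x in Ioi (0 : ℝ), p n * (exp (-(s * x)) * F n x) = p n * m n := by
    rw [integral_const_mul, hF_integral]
  have hnorm (n : ℕ) :
      ∫ x in Ioi (0 : ℝ), ‖p n * (exp (-(s * x)) * F n x)‖ = p n * m n := by
    rw [← hint n]
    refine setIntegral_congr_fun measurableSet_Ioi fun x hx ↦ Real.norm_of_nonneg ?_
    exact mul_nonneg (hp n) (mul_nonneg (exp_nonneg _) (hF_nonneg n x hx))
  have hsum : Summable fun n ↦ p n * m n :=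
    hp_sum.of_nonneg_of_le (fun n ↦ mul_nonneg (hp n) (hm_nonneg n))
      fun n ↦ mul_le_of_le_one_right (hp n) (hm n)
  simp_rw [← tsum_mul_left, mul_left_comm (exp _)]
  rw [← integral_tsum_of_summable_integral_norm (fun n ↦ (hF n).const_mul (p n))
    (by simpa only [hnorm] using hsum)]
  simp_rw [hint]

lemma inv_rpow_le_one {y b : ℝ} (hy : 1 ≤ y) (hb : 0 ≤ b) : (y ^ b)⁻¹ ≤ 1 :=
  inv_le_one_of_one_le₀ (one_le_rpow hy hb)

/-- **Matching density for Gamma mixtures (linear boundary).** For a mixture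
`f = Σ pₙ f_{aₙ,bₙ}` with `aₙ ≥ 2/μ²`, the mixture of convolutions of Gamma densities
`g = Σ pₙ (f_{cₙ⁺,bₙ} ⋆ f_{cₙ⁻,bₙ})` is a probability density on `(0,∞)` whose Laplace
transform equals the boundary transform of `f`. -/
theorem gamma_mixture_matching_density
    (μ : ℝ) (hμ : 0 < μ) (p a bshape : ℕ → ℝ)
    (hp : ∀ n, 0 ≤ p n) (hpsum : ∑' n, p n = 1)
    (hbshape : ∀ n, 0 < bshape n) (ha : ∀ n, 2 / μ ^ 2 ≤ a n)
    (cp cm : ℕ → ℝ)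
    (hcp : ∀ n, cp n = a n / 2 * (μ + Real.sqrt (μ ^ 2 - 2 / a n)))
    (hcm : ∀ n, cm n = a n / 2 * (μ - Real.sqrt (μ ^ 2 - 2 / a n)))
    (f g : ℝ → ℝ)
    (hf : ∀ t, f t = ∑' n, p n * gammaDensity (a n) (bshape n) t)
    (hg : ∀ x, g x = ∑' n,
      p n * posConv (gammaDensity (cp n) (bshape n)) (gammaDensity (cm n) (bshape n)) x) :
    Measurable g ∧ (∀ x ∈ Ioi (0 : ℝ), 0 ≤ g x) ∧ (∫ x in Ioi (0 : ℝ), g x = 1) ∧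
    ∀ α > (0 : ℝ),
      ∫ x in Ioi (0 : ℝ), Real.exp (-α * x) * g x
        = ∫ t in Ioi (0 : ℝ), Real.exp (-t * (α * μ + α ^ 2 / 2)) * f t := by
  have hμ2 : 0 < μ ^ 2 := by positivity
  have ha_pos (n : ℕ) : 0 < a n := lt_of_lt_of_le (by positivity) (ha n)
  have hdisc (n : ℕ) : 0 ≤ μ ^ 2 - 2 / a n := by
    rw [sub_nonneg, div_le_comm₀ (ha_pos n) hμ2]
    exact ha n
  have hsqrt (n : ℕ) : √(μ ^ 2 - 2 / a n) < μ := by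
    rw [sqrt_lt' hμ]
    have := ha_pos n
    linarith [show 0 < 2 / a n by positivity]
  have hcp_pos (n : ℕ) : 0 < cp n := by
    rw [hcp]
    have := ha_pos n
    positivity
  have hcm_pos (n : ℕ) : 0 < cm n := by
    rw [hcm]
    exact mul_pos (half_pos (ha_pos n)) (sub_pos.2 (hsqrt n))
  have hprod (n : ℕ) (s : ℝ) :
      (1 + s * cp n) * (1 + s * cm n) = 1 + (s * μ + s ^ 2 / 2) * a n := by
    have hcc : cp n * cm n = a n / 2 := by
      have h : cp n * cm n = (a n / 2) ^ 2 * (μ ^ 2 - √(μ ^ 2 - 2 / a n) ^ 2) := by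
        rw [hcp, hcm]
        ring
      rw [h, sq_sqrt (hdisc n)]
      have := (ha_pos n).ne'
      field_simp
      ring
    have hadd : cp n + cm n = a n * μ := by
      rw [hcp, hcm]
      ring
    linear_combination s * hadd + s ^ 2 * hcc
  have hp_sum : Summable p := by
    by_contra h
    simp [tsum_eq_zero_of_not_summable h] at hpsum
  have hconv_nonneg (n : ℕ) (x : ℝ) :
      0 ≤ posConv (gammaDensity (cp n) (bshape n)) (gammaDensity (cm n) (bshape n)) x :=
    posConv_nonneg (fun t ht ↦ gammaDensity_nonneg (hcp_pos n) (hbshape n) ht)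
      (fun t ht ↦ gammaDensity_nonneg (hcm_pos n) (hbshape n) ht) x
  have hone_le (n : ℕ) {s : ℝ} (hs : 0 ≤ s) : 1 ≤ 1 + s * a n :=
    le_add_of_nonneg_right (mul_nonneg hs (ha_pos n).le)
  have hg_laplace (s : ℝ) (hs : 0 ≤ s) : ∫ x in Ioi (0 : ℝ), exp (-(s * x)) * g x
      = ∑' n, p n * ((1 + (s * μ + s ^ 2 / 2) * a n) ^ bshape n)⁻¹ := by
    simp_rw [hg]
    refine integral_exp_mul_tsum hp hp_sum (fun n x _ ↦ hconv_nonneg n x)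
      (fun n ↦ integrableOn_exp_mul_posConv_gammaDensity (hcp_pos n) (hcm_pos n) (hbshape n) hs)
      (fun n ↦ ?_) (fun n ↦ inv_rpow_le_one (hone_le n (by positivity)) (hbshape n).le)
    rw [integral_exp_mul_posConv_gammaDensity (hcp_pos n) (hcm_pos n) (hbshape n) hs, hprod]
  have hf_laplace (s : ℝ) (hs : 0 ≤ s) : ∫ t in Ioi (0 : ℝ), exp (-(s * t)) * f t
      = ∑' n, p n * ((1 + s * a n) ^ bshape n)⁻¹ := by
    simp_rw [hf]
    exact integral_exp_mul_tsum hp hp_sum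
      (fun n t ht ↦ gammaDensity_nonneg (ha_pos n) (hbshape n) (le_of_lt ht))
      (fun n ↦ integrableOn_exp_mul_gammaDensity_s8 (ha_pos n) (hbshape n) hs)
      (fun n ↦ integral_exp_mul_gammaDensity_s8 (ha_pos n) (hbshape n) hs)
      (fun n ↦ inv_rpow_le_one (hone_le n hs) (hbshape n).le)
  refine ⟨?_, fun x _ ↦ ?_, ?_, fun α hα ↦ ?_⟩
  · rw [funext hg]
    exact Measurable.tsum_of_nonneg
      (fun n ↦ (measurable_posConv (measurable_gammaDensity _ _)
        (measurable_gammaDensity _ _)).const_mul _)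
      (fun n x ↦ mul_nonneg (hp n) (hconv_nonneg n x))
  · rw [hg]
    exact tsum_nonneg fun n ↦ mul_nonneg (hp n) (hconv_nonneg n x)
  · simpa [hpsum] using hg_laplace 0 le_rfl
  · have hs : 0 ≤ α * μ + α ^ 2 / 2 := by positivity
    simpa only [neg_mul, mul_comm (α * μ + α ^ 2 / 2)] using
      (hg_laplace α hα.le).trans (hf_laplace _ hs).symm
end

section
/- Let v, d, B, C > 0 and A ∈ ℝ be such that d + A + s + B·√(C + s) > 0 for every s > 0. Define h(t) := (B/(2·Γ(v)·√π))·∫₀^t (t−x)^{−3/2}·x^v·exp(−C·(t−x) − x·(d+A) − x²·B²/(4·(t−x))) dx for t > 0. Then for every s > 0: ∫₀^∞ e^{−st}·h(t) dt = (d + A + s + B·√(s + C))^{−v}. -/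
open MeasureTheory Real Set

theorem integral_exp_neg_sub_div_sq_mul {a b : ℝ} (ha : 0 < a) (hb : 0 < b) :
    ∫ y in Ioi (0 : ℝ), (a + b / y ^ 2) * exp (-(a * y - b / y) ^ 2) = √π := by
  have himg : (fun y : ℝ => a * y - b / y) '' Ioi 0 = univ := by
    refine eq_univ_of_forall fun z => ?_
    have hlt : |z| < √(z ^ 2 + 4 * a * b) := by
      rw [← sqrt_sq_eq_abs]
      exact sqrt_lt_sqrt (sq_nonneg z) (by nlinarith [mul_pos ha hb])
    have hsq : √(z ^ 2 + 4 * a * b) ^ 2 = z ^ 2 + 4 * a * b := sq_sqrt (by positivity)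
    have hpos : 0 < z + √(z ^ 2 + 4 * a * b) := by linarith [neg_abs_le z]
    refine ⟨(z + √(z ^ 2 + 4 * a * b)) / (2 * a), by rw [mem_Ioi]; positivity, ?_⟩
    generalize √(z ^ 2 + 4 * a * b) = w at hsq hpos
    have hne : z + w ≠ 0 := hpos.ne'
    dsimp only
    field_simp
    linear_combination hsq
  have hinj : InjOn (fun y : ℝ => a * y - b / y) (Ioi 0) := by
    refine StrictMonoOn.injOn fun x hx y hy hxy => ?_
    have : b / y < b / x := div_lt_div_of_pos_left hb hx hxy
    have : a * x < a * y := mul_lt_mul_of_pos_left hxy ha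
    linarith
  have hderiv : ∀ y ∈ Ioi (0 : ℝ),
      HasDerivWithinAt (fun y : ℝ => a * y - b / y) (a + b / y ^ 2) (Ioi 0) y := by
    intro y hy
    have hy0 : y ≠ 0 := ne_of_gt hy
    refine HasDerivAt.hasDerivWithinAt ?_
    refine (((hasDerivAt_id' y).const_mul a).sub ((hasDerivAt_inv hy0).const_mul b)).congr_deriv ?_
    field_simp
    ring
  have h := integral_image_eq_integral_abs_deriv_smul measurableSet_Ioi hderiv hinj
    (fun z => exp (-z ^ 2))
  rw [himg, setIntegral_univ] at h
  have hg := integral_gaussian 1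
  simp only [neg_mul, one_mul, div_one] at hg
  rw [← hg, h]
  refine setIntegral_congr_fun measurableSet_Ioi fun y hy => ?_
  simp only [mem_Ioi] at hy
  simp only [smul_eq_mul]
  rw [abs_of_pos (by positivity)]

theorem integral_exp_neg_sub_div_sq {a b : ℝ} (ha : 0 < a) (hb : 0 < b) :
    ∫ y in Ioi (0 : ℝ), exp (-(a * y - b / y) ^ 2) = √π / (2 * a) := by
  have hsum := integral_exp_neg_sub_div_sq_mul ha hb
  have hint : IntegrableOn (fun y => (a + b / y ^ 2) * exp (-(a * y - b / y) ^ 2)) (Ioi 0) := by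
    by_contra hn
    rw [integral_undef hn] at hsum
    exact (sqrt_pos.2 pi_pos).ne hsum
  have hint₁ : IntegrableOn (fun y => a * exp (-(a * y - b / y) ^ 2)) (Ioi 0) := by
    refine hint.mono' (by fun_prop) ?_
    refine (ae_restrict_iff' measurableSet_Ioi).2 (.of_forall fun y hy => ?_)
    simp only [mem_Ioi] at hy
    rw [norm_of_nonneg (by positivity)]
    gcongr
    have : 0 < b / y ^ 2 := by positivity
    linarith
  have hint₂ : IntegrableOn (fun y => b / y ^ 2 * exp (-(a * y - b / y) ^ 2)) (Ioi 0) := by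
    refine (hint.sub hint₁).congr (.of_forall fun y => ?_)
    simp only [Pi.sub_apply]
    ring
  have himg : (fun y : ℝ => b / a / y) '' Ioi 0 = Ioi 0 := by
    ext z
    refine ⟨?_, fun hz => ⟨b / a / z, ?_, ?_⟩⟩
    · rintro ⟨y, hy, rfl⟩
      simp only [mem_Ioi] at hy ⊢
      positivity
    · simp only [mem_Ioi] at hz ⊢
      positivity
    · have : z ≠ 0 := ne_of_gt hz
      field_simp
  have hinj : InjOn (fun y : ℝ => b / a / y) (Ioi 0) := by
    intro x hx y hy hxy
    have hx0 : x ≠ 0 := ne_of_gt hx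
    have hy0 : y ≠ 0 := ne_of_gt hy
    field_simp at hxy
    exact hxy.symm
  have hderiv : ∀ y ∈ Ioi (0 : ℝ),
      HasDerivWithinAt (fun y : ℝ => b / a / y) (-(b / a / y ^ 2)) (Ioi 0) y := by
    intro y hy
    have hy0 : y ≠ 0 := ne_of_gt hy
    refine HasDerivAt.hasDerivWithinAt ?_
    refine ((hasDerivAt_inv hy0).const_mul (b / a)).congr_deriv ?_
    field_simp
  have hsymm := integral_image_eq_integral_abs_deriv_smul measurableSet_Ioi hderiv hinj
    (fun y => a * exp (-(a * y - b / y) ^ 2))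
  rw [himg] at hsymm
  have heq : ∫ y in Ioi (0 : ℝ), a * exp (-(a * y - b / y) ^ 2)
      = ∫ y in Ioi (0 : ℝ), b / y ^ 2 * exp (-(a * y - b / y) ^ 2) := by
    rw [hsymm]
    refine setIntegral_congr_fun measurableSet_Ioi fun y hy => ?_
    simp only [mem_Ioi] at hy
    simp only [smul_eq_mul]
    rw [abs_neg, abs_of_pos (by positivity)]
    have h₁ : a * (b / a / y) - b / (b / a / y) = -(a * y - b / y) := by
      field_simp
      ring
    rw [h₁, neg_sq]
    field_simp
  simp only [add_mul] at hsum
  rw [integral_add hint₁ hint₂, ← heq, integral_const_mul] at hsum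
  rw [eq_div_iff (by positivity)]
  linarith

/-- The total mass of the (unnormalised) Lévy density, exponentially tilted. -/
theorem integral_rpow_mul_exp_neg_mul_sub_div {a k : ℝ} (ha : 0 < a) (hk : 0 < k) :
    ∫ u in Ioi (0 : ℝ), u ^ (-(3 : ℝ) / 2) * exp (-k * u - a ^ 2 / u)
      = √π / a * exp (-(2 * a * √k)) := by
  rw [← integral_comp_rpow_Ioi _ (show (-2 : ℝ) ≠ 0 by norm_num)]
  have h : √π / a * exp (-(2 * a * √k))
      = 2 * exp (-(2 * a * √k)) * (√π / (2 * a)) := by field_simp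
  rw [h, ← integral_exp_neg_sub_div_sq ha (sqrt_pos.2 hk), ← integral_const_mul]
  refine setIntegral_congr_fun measurableSet_Ioi fun y hy => ?_
  simp only [mem_Ioi] at hy
  simp only [smul_eq_mul]
  have h₁ : (y ^ (-2 : ℝ)) ^ (-(3 : ℝ) / 2) = y ^ (3 : ℝ) := by
    rw [← rpow_mul hy.le]; norm_num
  have h₂ : y ^ (-2 - 1 : ℝ) * y ^ (3 : ℝ) = 1 := by
    rw [← rpow_add hy]; norm_num
  have h₃ : y ^ (-2 : ℝ) = (y ^ 2)⁻¹ := by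
    rw [rpow_neg hy.le]; norm_cast
  have h₄ : -k * (y ^ 2)⁻¹ - a ^ 2 / (y ^ 2)⁻¹ = -(2 * a * √k) + -(a * y - √k / y) ^ 2 := by
    have := sq_sqrt hk.le
    field_simp
    linear_combination this
  rw [h₁, h₃, h₄, exp_add, abs_of_neg (by norm_num)]
  linear_combination 2 * exp (-(2 * a * √k)) * exp (-(a * y - √k / y) ^ 2) * h₂

/-- Fubini on the positive quadrant, in the coordinates `(x, t) = (x, x + u)`. -/
theorem setIntegral_Ioi_setIntegral_Ioo_sub {F : ℝ → ℝ → ℝ}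
    (hF : IntegrableOn (Function.uncurry F) (Ioi 0 ×ˢ Ioi 0)) :
    ∫ t in Ioi (0 : ℝ), ∫ x in Ioo (0 : ℝ) t, F x (t - x)
      = ∫ x in Ioi (0 : ℝ), ∫ u in Ioi (0 : ℝ), F x u := by
  set G : ℝ × ℝ → ℝ := (Ioi 0 ×ˢ Ioi 0).indicator (Function.uncurry F) with hG
  have hGint : Integrable G (volume.prod volume) :=
    (integrable_indicator_iff (measurableSet_Ioi.prod measurableSet_Ioi)).2 hF
  have hshear : Integrable (Function.uncurry fun x t => G (x, t - x)) (volume.prod volume) :=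
    (measurePreserving_prod_sub volume volume).integrable_comp_of_integrable hGint
  have hswap := integral_integral_swap hshear
  have hleft : ∀ t, ∫ x, G (x, t - x) = ∫ x in Ioo (0 : ℝ) t, F x (t - x) := by
    intro t
    rw [← integral_indicator measurableSet_Ioo]
    congr 1 with x
    simp [hG, indicator_apply]
  have hright : ∀ x, ∫ t, G (x, t - x)
      = (Ioi 0).indicator (fun x => ∫ u in Ioi (0 : ℝ), F x u) x := by
    intro x
    rw [integral_sub_right_eq_self (fun u => G (x, u)) x]
    by_cases hx : 0 < x
    · rw [indicator_of_mem (mem_Ioi.2 hx), ← integral_indicator measurableSet_Ioi]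
      congr 1 with u
      simp [hG, indicator_apply, hx]
    · simp [hG, hx]
  simp only [hleft, hright] at hswap
  rw [integral_indicator measurableSet_Ioi] at hswap
  rw [hswap]
  refine setIntegral_eq_integral_of_forall_compl_eq_zero fun t ht => ?_
  rw [Ioo_eq_empty (by simpa using ht), setIntegral_empty]

/-- **Laplace transform of the auxiliary kernel (Lemma A.2).** For positive `v, d, B, C`
and real `A` with `d + A + s + B√(C+s) > 0` for all `s > 0`, the function
`h(t) = (B/(2Γ(v)√π)) ∫₀^t (t−x)^{−3/2} x^v e^{−C(t−x) − x(d+A) − x²B²/(4(t−x))} dx`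
has Laplace transform `(d + A + s + B√(s+C))^{−v}`. -/
theorem laplace_gamma_lemma
    (v d B C : ℝ) (A : ℝ) (hv : 0 < v) (hd : 0 < d) (hB : 0 < B) (hC : 0 < C)
    (hpos : ∀ s > (0 : ℝ), 0 < d + A + s + B * Real.sqrt (C + s))
    (h : ℝ → ℝ)
    (hh : ∀ t, h t = B / (2 * Real.Gamma v * Real.sqrt π) *
      ∫ x in Ioo (0 : ℝ) t, (t - x) ^ (-(3 : ℝ) / 2) * x ^ v *
        Real.exp (-C * (t - x) - x * (d + A) - x ^ 2 * B ^ 2 / (4 * (t - x)))) :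
    ∀ s > (0 : ℝ),
      ∫ t in Ioi (0 : ℝ), Real.exp (-s * t) * h t
        = (d + A + s + B * Real.sqrt (s + C)) ^ (-v) := by
  intro s hs
  have hr := hpos s hs
  rw [add_comm C s] at hr
  set r := d + A + s + B * √(s + C) with hrdef
  have hk : 0 < s + C := by positivity
  have hΓ : 0 < Gamma v := Gamma_pos_of_pos hv
  have hπ : 0 < √π := sqrt_pos.2 pi_pos
  set F : ℝ → ℝ → ℝ := fun x u => x ^ v * exp (-(d + A + s) * x) *
    (u ^ (-(3 : ℝ) / 2) * exp (-(s + C) * u - (x * B / 2) ^ 2 / u)) with hF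
  have hFmeas : Measurable (Function.uncurry F) := by
    simp only [hF, Function.uncurry_def]
    fun_prop
  have hinner : ∀ x > 0, ∫ u in Ioi (0 : ℝ), F x u
      = 2 * √π / B * (x ^ (v - 1) * exp (-(r * x))) := by
    intro x hx
    simp only [hF]
    rw [integral_const_mul, integral_rpow_mul_exp_neg_mul_sub_div (by positivity) hk,
      rpow_sub_one hx.ne', show -(r * x) = -(d + A + s) * x + -(2 * (x * B / 2) * √(s + C)) by
        rw [hrdef]; ring, exp_add]
    field_simp
  have hgamma := integral_rpow_mul_exp_neg_mul_Ioi hv hr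
  have hint_gamma : IntegrableOn (fun x => x ^ (v - 1) * exp (-(r * x))) (Ioi 0) := by
    by_contra hn
    rw [integral_undef hn] at hgamma
    have : 0 < (1 / r) ^ v * Gamma v := by positivity
    exact this.ne hgamma
  have hFnonneg : ∀ x > 0, ∀ u > 0, 0 ≤ F x u := by
    intro x hx u hu
    simp only [hF]
    positivity
  have hFint : IntegrableOn (Function.uncurry F) (Ioi 0 ×ˢ Ioi 0) := by
    rw [IntegrableOn, Measure.volume_eq_prod, ← Measure.prod_restrict,
      integrable_prod_iff hFmeas.aestronglyMeasurable]
    constructor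
    · refine (ae_restrict_iff' measurableSet_Ioi).2 (.of_forall fun x hx => ?_)
      rw [mem_Ioi] at hx
      by_contra hn
      have hval : ∫ u in Ioi (0 : ℝ), Function.uncurry F (x, u) = _ := hinner x hx
      rw [integral_undef hn] at hval
      have : 0 < 2 * √π / B * (x ^ (v - 1) * exp (-(r * x))) := by positivity
      exact this.ne hval
    · refine IntegrableOn.congr_fun (hint_gamma.const_mul (2 * √π / B)) (fun x hx => ?_)
        measurableSet_Ioi
      rw [mem_Ioi] at hx
      rw [← hinner x hx]
      refine setIntegral_congr_fun measurableSet_Ioi fun u hu => ?_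
      exact (norm_of_nonneg (hFnonneg x hx u hu)).symm
  have hkernel : ∀ t, exp (-s * t) * h t
      = B / (2 * Gamma v * √π) * ∫ x in Ioo (0 : ℝ) t, F x (t - x) := by
    intro t
    rw [hh, mul_left_comm, ← integral_const_mul]
    congr 1
    refine setIntegral_congr_fun measurableSet_Ioo fun x hx => ?_
    have hne : t - x ≠ 0 := (sub_pos.2 hx.2).ne'
    have hexp : exp (-s * t) *
          exp (-C * (t - x) - x * (d + A) - x ^ 2 * B ^ 2 / (4 * (t - x)))
        = exp (-(d + A + s) * x) * exp (-(s + C) * (t - x) - (x * B / 2) ^ 2 / (t - x)) := by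
      rw [← exp_add, ← exp_add]
      congr 1
      field_simp
      ring
    simp only [hF]
    linear_combination (t - x) ^ (-(3 : ℝ) / 2) * x ^ v * hexp
  simp only [hkernel]
  rw [integral_const_mul, setIntegral_Ioi_setIntegral_Ioo_sub hFint,
    setIntegral_congr_fun measurableSet_Ioi hinner, integral_const_mul, hgamma,
    one_div, inv_rpow hr.le, ← rpow_neg hr.le]
  field_simp
end

section
/- Let λ > 0. Then for every α > 0: ∫₀^∞ e^{−αx}·√(2λ)·sin(√(2λ)·x) dx = 2λ/(2λ + α²) and ∫₀^∞ e^{−t·α²/2}·λ·e^{−λt} dt = 2λ/(2λ + α²). Thus the sign-changing function g(x) = √(2λ)·sin(√(2λ)·x) satisfies the zero-boundary transform equation ∫₀^∞ e^{−αx}·g(x) dx = ∫₀^∞ e^{−t·α²/2}·f(t) dt for the Exponential(λ) target density f(t) = λ·e^{−λt}. -/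
open MeasureTheory Real Set

/-- The Laplace transform of the sine. -/
theorem integral_exp_neg_mul_sin_Ioi {a : ℝ} (ha : 0 < a) (b : ℝ) :
    ∫ x in Ioi (0 : ℝ), Real.exp (-a * x) * Real.sin (b * x) = b / (a ^ 2 + b ^ 2) := by
  have hre : (⟨-a, b⟩ : ℂ).re < 0 := neg_lt_zero.mpr ha
  have him : ∀ x : ℝ, Real.exp (-a * x) * Real.sin (b * x) =
      RCLike.im (Complex.exp ((⟨-a, b⟩ : ℂ) * x)) := by
    intro x
    simp [Complex.exp_im]
  simp_rw [him]
  rw [integral_im (integrableOn_exp_mul_complex_Ioi hre 0), integral_exp_mul_complex_Ioi hre]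
  simp [Complex.normSq_apply, sq, neg_div]

/-- **Counterexample for the zero boundary with exponential target.** The sign-changing
function `g(x) = √(2λ) sin(√(2λ) x)` satisfies the zero-boundary transform equation
`∫₀^∞ e^{−αx} g(x) dx = ∫₀^∞ e^{−tα²/2} λe^{−λt} dt = 2λ/(2λ+α²)` for all `α > 0`,
even though `g` is not a probability density. -/
theorem zero_boundary_exponential_counterexample
    (lam : ℝ) (hlam : 0 < lam) :
    ∀ α > (0 : ℝ),
      (∫ x in Ioi (0 : ℝ),
          Real.exp (-α * x) * (Real.sqrt (2 * lam) * Real.sin (Real.sqrt (2 * lam) * x))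
        = 2 * lam / (2 * lam + α ^ 2)) ∧
      (∫ t in Ioi (0 : ℝ), Real.exp (-t * α ^ 2 / 2) * (lam * Real.exp (-lam * t))
        = 2 * lam / (2 * lam + α ^ 2)) := by
  intro α hα
  have hsq : Real.sqrt (2 * lam) ^ 2 = 2 * lam := Real.sq_sqrt (by positivity)
  constructor
  · simp_rw [mul_left_comm _ (Real.sqrt (2 * lam))]
    rw [integral_const_mul, integral_exp_neg_mul_sin_Ioi hα, ← mul_div_assoc, ← sq, hsq, add_comm]
  · have hrate : -(lam + α ^ 2 / 2) < 0 := neg_lt_zero.mpr (by positivity)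
    have hexp : ∀ t : ℝ, Real.exp (-t * α ^ 2 / 2) * (lam * Real.exp (-lam * t)) =
        lam * Real.exp (-(lam + α ^ 2 / 2) * t) := by
      intro t
      rw [mul_left_comm, ← Real.exp_add]
      ring_nf
    simp_rw [hexp]
    rw [integral_const_mul, integral_exp_mul_Ioi hrate, mul_zero, Real.exp_zero]
    field_simp
end

section
/- Let μ > 0 and let z : (0,∞) → ℝ be Lebesgue integrable. If ∫₀^∞ exp(−t·(α·μ + α²/2))·z(t) dt = 0 for every α > 0, then z = 0 almost everywhere on (0,∞). -/
open MeasureTheory Real Set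

/-- If all moments `∫ e^{-nt} w(t) dt` over `(0,∞)` vanish, so do the integrals of `w` against
polynomials in `e^{-t}`. -/
lemma integral_polynomial_eval_exp_neg_mul_eq_zero {w : ℝ → ℝ} (hw : IntegrableOn w (Ioi 0))
    (h : ∀ n : ℕ, ∫ t in Ioi (0 : ℝ), exp (-t) ^ n * w t = 0) (p : Polynomial ℝ) :
    IntegrableOn (fun t ↦ p.eval (exp (-t)) * w t) (Ioi 0) ∧
      ∫ t in Ioi (0 : ℝ), p.eval (exp (-t)) * w t = 0 := by
  have hint (n : ℕ) : IntegrableOn (fun t ↦ exp (-t) ^ n * w t) (Ioi 0) := by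
    refine hw.bdd_mul (c := 1) (by fun_prop) ?_
    filter_upwards [ae_restrict_mem measurableSet_Ioi] with t ht
    rw [norm_pow, norm_of_nonneg (exp_pos _).le]
    exact pow_le_one₀ (exp_pos _).le (exp_le_one_iff.2 (neg_nonpos.2 (le_of_lt ht)))
  induction p using Polynomial.induction_on' with
  | add p q hp hq =>
    simp only [Polynomial.eval_add, add_mul]
    exact ⟨hp.1.add hq.1, by rw [integral_add hp.1 hq.1, hp.2, hq.2, add_zero]⟩
  | monomial n a =>
    simp only [Polynomial.eval_monomial, mul_assoc]
    exact ⟨(hint n).const_mul a, by rw [integral_const_mul, h n, mul_zero]⟩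

/-- If all moments `∫ e^{-nt} w(t) dt` over `(0,∞)` vanish, so do the integrals of `w` against
continuous functions of `e^{-t}`. -/
lemma integral_continuousOn_comp_exp_neg_mul_eq_zero {w : ℝ → ℝ} (hw : IntegrableOn w (Ioi 0))
    (h : ∀ n : ℕ, ∫ t in Ioi (0 : ℝ), exp (-t) ^ n * w t = 0) {f : ℝ → ℝ}
    (hf : ContinuousOn f (Icc 0 1)) :
    ∫ t in Ioi (0 : ℝ), f (exp (-t)) * w t = 0 := by
  by_cases hfw : IntegrableOn (fun t ↦ f (exp (-t)) * w t) (Ioi 0)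
  swap
  · exact integral_undef hfw
  have key (ε : ℝ) (hε : 0 < ε) :
      ‖∫ t in Ioi (0 : ℝ), f (exp (-t)) * w t‖ ≤ ε * ∫ t in Ioi (0 : ℝ), ‖w t‖ := by
    obtain ⟨p, hp⟩ := exists_polynomial_near_of_continuousOn 0 1 f hf ε hε
    obtain ⟨hpi, hp0⟩ := integral_polynomial_eval_exp_neg_mul_eq_zero hw h p
    have hsub := integral_sub hfw hpi
    rw [hp0, sub_zero] at hsub
    rw [← hsub, ← integral_const_mul]
    refine norm_integral_le_of_norm_le (hw.norm.const_mul ε) ?_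
    filter_upwards [ae_restrict_mem measurableSet_Ioi] with t ht
    rw [← sub_mul, norm_mul, norm_sub_rev]
    gcongr
    exact (hp _ ⟨(exp_pos _).le, exp_le_one_iff.2 (neg_nonpos.2 (le_of_lt ht))⟩).le
  rw [← norm_le_zero_iff]
  have hlim : Filter.Tendsto (fun ε : ℝ ↦ ε * ∫ t in Ioi (0 : ℝ), ‖w t‖)
      (nhdsWithin 0 (Ioi 0)) (nhds 0) := by
    refine Filter.Tendsto.mono_left ?_ nhdsWithin_le_nhds
    exact (continuous_mul_const _).tendsto' 0 0 (zero_mul _)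
  exact ge_of_tendsto hlim (by filter_upwards [self_mem_nhdsWithin] with ε hε using key ε hε)

/-- A compactly supported continuous function vanishing at `0` stays continuous after composition
with `-log`. -/
lemma HasCompactSupport.continuous_comp_neg_log {g : ℝ → ℝ} (hg : HasCompactSupport g)
    (hgc : Continuous g) (hg0 : g 0 = 0) : Continuous fun y ↦ g (-log y) := by
  rw [continuous_iff_continuousAt]
  intro y
  rcases eq_or_ne y 0 with rfl | hy
  · rw [continuousAt_iff_punctured_nhds]
    simp only [log_zero, neg_zero, hg0]
    exact (hg.is_zero_at_infty.mono_left atTop_le_cocompact).comp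
      (Filter.tendsto_neg_atBot_atTop.comp tendsto_log_nhdsNE_zero)
  · exact hgc.continuousAt.comp (continuousAt_log hy).neg

/-- An integrable function on `(0,∞)` is determined by the values of its Laplace transform at the
positive integers. -/
lemma ae_eq_zero_of_forall_integral_exp_neg_pow_succ_mul_eq_zero {z : ℝ → ℝ}
    (hz : IntegrableOn z (Ioi 0))
    (h : ∀ n : ℕ, ∫ t in Ioi (0 : ℝ), exp (-t) ^ (n + 1) * z t = 0) :
    ∀ᵐ t ∂(volume.restrict (Ioi (0 : ℝ))), z t = 0 := by
  have hw : IntegrableOn (fun t ↦ exp (-t) * z t) (Ioi 0) := by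
    refine hz.bdd_mul (c := 1) (by fun_prop) ?_
    filter_upwards [ae_restrict_mem measurableSet_Ioi] with t ht
    rw [norm_of_nonneg (exp_pos _).le]
    exact exp_le_one_iff.2 (neg_nonpos.2 (le_of_lt ht))
  have hw0 : ∀ᵐ t, t ∈ Ioi (0 : ℝ) → exp (-t) * z t = 0 := by
    refine isOpen_Ioi.ae_eq_zero_of_integral_contDiff_smul_eq_zero hw.locallyIntegrableOn ?_
    intro g hg hgs hgsupp
    have hzero (t : ℝ) (ht : t ∉ Ioi (0 : ℝ)) : g t = 0 :=
      image_eq_zero_of_notMem_tsupport fun h' ↦ ht (hgsupp h')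
    have hcont := hgs.continuous_comp_neg_log hg.continuous (hzero 0 (by simp))
    have := integral_continuousOn_comp_exp_neg_mul_eq_zero hw
      (fun n ↦ by simpa only [pow_succ, mul_assoc] using h n) hcont.continuousOn
    simp only [log_exp, neg_neg] at this
    rw [← this]
    exact (setIntegral_eq_integral_of_forall_compl_eq_zero fun t ht ↦ by simp [hzero t ht]).symm
  rw [ae_restrict_iff' measurableSet_Ioi]
  filter_upwards [hw0] with t ht hpos
  exact (mul_eq_zero.1 (ht hpos)).resolve_left (exp_pos _).ne'

/-- The map `α ↦ αμ + α²/2` takes every positive value on `(0,∞)`. -/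
lemma exists_pos_mul_add_sq_div_two_eq (μ : ℝ) {s : ℝ} (hs : 0 < s) :
    ∃ α > (0 : ℝ), α * μ + α ^ 2 / 2 = s := by
  have hsq : √(μ ^ 2 + 2 * s) ^ 2 = μ ^ 2 + 2 * s := sq_sqrt (by positivity)
  refine ⟨√(μ ^ 2 + 2 * s) - μ, sub_pos.2 (lt_sqrt_of_sq_lt (by linarith)), ?_⟩
  linear_combination hsq / 2

/-- **Injectivity of the linear-boundary transform.** For `μ > 0`, if an integrable
function `z` on `(0,∞)` satisfies `∫₀^∞ e^{−t(αμ + α²/2)} z(t) dt = 0` for every `α > 0`,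
then `z = 0` almost everywhere on `(0,∞)`. -/
theorem linear_boundary_transform_injective
    (μ : ℝ) (hμ : 0 < μ) (z : ℝ → ℝ) (hz : IntegrableOn z (Ioi 0))
    (h : ∀ α > (0 : ℝ), ∫ t in Ioi (0 : ℝ), Real.exp (-t * (α * μ + α ^ 2 / 2)) * z t = 0) :
    ∀ᵐ t ∂(volume.restrict (Ioi (0 : ℝ))), z t = 0 := by
  refine ae_eq_zero_of_forall_integral_exp_neg_pow_succ_mul_eq_zero hz fun n ↦ ?_
  obtain ⟨α, hα, hαs⟩ := exists_pos_mul_add_sq_div_two_eq μ (s := (n : ℝ) + 1) (by positivity)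
  refine (integral_congr_ae (.of_forall fun t ↦ ?_)).trans (h α hα)
  simp only [hαs, ← exp_nat_mul]
  push_cast
  ring_nf
end

section
/- Let p₀ > 0 and let z : (0,∞) → ℝ be measurable with ∫₀^∞ t^{−p/2}·|z(t)| dt < ∞ for every p ∈ [0, p₀). If ∫₀^∞ exp(−α·√t − α²·t/2)·z(t) dt = 0 for every α > 0, then z = 0 almost everywhere on (0,∞). -/
open MeasureTheory Real Set

/-- Two finite measures with the same moment-generating function, finite near `0`, have the
same image measure. -/
lemma map_eq_of_mgf_eq_near_zero {Ω : Type*} [MeasurableSpace Ω] {μ ν : Measure Ω}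
    [IsFiniteMeasure μ] [IsFiniteMeasure ν] {X : Ω → ℝ} (hX : Measurable X) {r : ℝ} (hr : 0 < r)
    (hμ : ∀ s ∈ Ioo (-r) r, Integrable (fun ω => exp (s * X ω)) μ)
    (hν : ∀ s ∈ Ioo (-r) r, Integrable (fun ω => exp (s * X ω)) ν)
    (h : ∀ s ∈ Ioo (-r) r, ProbabilityTheory.mgf X μ s = ProbabilityTheory.mgf X ν s) :
    μ.map X = ν.map X := by
  have key : EqOn (ProbabilityTheory.complexMGF X μ) (ProbabilityTheory.complexMGF X ν)
      {w | w.re ∈ Ioo (-r) r} := by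
    have hX' : AnalyticOnNhd ℂ (ProbabilityTheory.complexMGF X μ) {w | w.re ∈ Ioo (-r) r} :=
      ProbabilityTheory.analyticOnNhd_complexMGF.mono fun w hw =>
        interior_maximal (fun s hs => hμ s hs) isOpen_Ioo hw
    have hY' : AnalyticOnNhd ℂ (ProbabilityTheory.complexMGF X ν) {w | w.re ∈ Ioo (-r) r} :=
      ProbabilityTheory.analyticOnNhd_complexMGF.mono fun w hw =>
        interior_maximal (fun s hs => hν s hs) isOpen_Ioo hw
    refine AnalyticOnNhd.eqOn_of_preconnected_of_frequently_eq hX' hY'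
      ((convex_Ioo (-r) r).linear_preimage Complex.reLm).isPreconnected
      (z₀ := ((0 : ℝ) : ℂ)) (by simp [hr]) ?_
    have hreal : ∃ᶠ x : ℝ in nhdsWithin 0 {0}ᶜ, ProbabilityTheory.complexMGF X μ x =
        ProbabilityTheory.complexMGF X ν x := by
      refine Filter.Eventually.frequently ?_
      filter_upwards [mem_nhdsWithin_of_mem_nhds (Ioo_mem_nhds (neg_lt_zero.mpr hr) hr)] with x hx
      rw [ProbabilityTheory.complexMGF_ofReal, ProbabilityTheory.complexMGF_ofReal, h x hx]
    have htend : Filter.Tendsto (fun x : ℝ => (x : ℂ)) (nhdsWithin 0 {0}ᶜ)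
        (nhdsWithin ((0 : ℝ) : ℂ) {((0 : ℝ) : ℂ)}ᶜ) := by
      refine Complex.continuous_ofReal.continuousAt.continuousWithinAt.tendsto_nhdsWithin ?_
      intro x hx
      simpa using hx
    exact htend.frequently hreal
  refine Measure.ext_of_charFun (funext fun t => ?_)
  rw [← ProbabilityTheory.complexMGF_mul_I hX.aemeasurable,
    ← ProbabilityTheory.complexMGF_mul_I hX.aemeasurable]
  exact key (by simp [hr])

/-- A real density whose exponential moments vanish near `0` along an a.e. left-invertible
random variable is a.e. zero. -/
lemma ae_eq_zero_of_integral_exp_mul_eq_zero {Ω : Type*} [MeasurableSpace Ω] {μ : Measure Ω}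
    {X : Ω → ℝ} (hX : Measurable X) {g : ℝ → Ω} (hg : Measurable g)
    (hgX : ∀ᵐ ω ∂μ, g (X ω) = ω) {w : Ω → ℝ} (hw : Measurable w) {r : ℝ} (hr : 0 < r)
    (hint : ∀ s ∈ Ioo (-r) r, Integrable (fun ω => exp (s * X ω) * w ω) μ)
    (h : ∀ s ∈ Ioo (-r) r, ∫ ω, exp (s * X ω) * w ω ∂μ = 0) :
    w =ᵐ[μ] 0 := by
  have hw0 : Integrable w μ := by simpa using hint 0 (by simp [hr])
  have hfin {f : Ω → ℝ} (hf : Integrable f μ) :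
      IsFiniteMeasure (μ.withDensity fun ω => ENNReal.ofReal (f ω)) :=
    isFiniteMeasure_withDensity_ofReal hf.2
  have hfin₁ := hfin hw0
  have hfin₂ := hfin hw0.neg
  have hpos (s : ℝ) (hs : s ∈ Ioo (-r) r) :
      Integrable (fun ω => max (w ω) 0 * exp (s * X ω)) μ := by
    refine (hint s hs).pos_part.congr (.of_forall fun ω => ?_)
    simp only [mul_comm (exp _)]
    rw [max_mul_of_nonneg _ _ (exp_pos _).le, zero_mul]
  have hneg (s : ℝ) (hs : s ∈ Ioo (-r) r) :
      Integrable (fun ω => max (-w ω) 0 * exp (s * X ω)) μ := by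
    refine (hint s hs).neg_part.congr (.of_forall fun ω => ?_)
    simp only [mul_comm (exp _)]
    rw [max_mul_of_nonneg _ _ (exp_pos _).le, zero_mul, neg_mul]
  have hmap : (μ.withDensity fun ω => ENNReal.ofReal (w ω)).map X =
      (μ.withDensity fun ω => ENNReal.ofReal (-w ω)).map X := by
    refine map_eq_of_mgf_eq_near_zero hX hr (fun s hs => ?_) (fun s hs => ?_) fun s hs => ?_
    · rw [integrable_withDensity_iff_integrable_smul' (by fun_prop) (by simp)]
      simpa [ENNReal.toReal_ofReal'] using hpos s hs
    · rw [integrable_withDensity_iff_integrable_smul' (by fun_prop) (by simp)]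
      simpa [ENNReal.toReal_ofReal'] using hneg s hs
    · rw [ProbabilityTheory.mgf, ProbabilityTheory.mgf,
        integral_withDensity_eq_integral_toReal_smul (by fun_prop) (by simp),
        integral_withDensity_eq_integral_toReal_smul (by fun_prop) (by simp)]
      simp only [ENNReal.toReal_ofReal', smul_eq_mul]
      rw [← sub_eq_zero, ← integral_sub (hpos s hs) (hneg s hs)]
      refine Eq.trans (integral_congr_ae (.of_forall fun ω => ?_)) (h s hs)
      rcases le_total (w ω) 0 with h0 | h0 <;> simp [h0, mul_comm]
  have hback (f : Ω → ENNReal) : ((μ.withDensity f).map X).map g = μ.withDensity f := by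
    rw [Measure.map_map hg hX]
    conv_rhs => rw [← Measure.map_id (μ := μ.withDensity f)]
    exact Measure.map_congr ((withDensity_absolutelyContinuous μ f).ae_le hgX)
  have heq := congrArg (Measure.map g) hmap
  rw [hback, hback, withDensity_eq_iff (by fun_prop) (by fun_prop)] at heq
  · filter_upwards [heq] with ω hω
    have := congrArg ENNReal.toReal hω
    simp only [ENNReal.toReal_ofReal'] at this
    rw [Pi.zero_apply]
    rcases le_total (w ω) 0 with h0 | h0
    · rw [max_eq_right h0, max_eq_left (neg_nonneg.mpr h0)] at this
      linarith
    · rw [max_eq_left h0, max_eq_right (neg_nonpos.mpr h0)] at this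
      linarith
  · rw [← setLIntegral_univ, ← withDensity_apply _ MeasurableSet.univ]
    exact measure_ne_top _ _

lemma integrableOn_rpow_mul_exp_neg_sub_sq {s : ℝ} (hs : 0 < s) :
    IntegrableOn (fun u : ℝ => u ^ (s - 1) * exp (-u - u ^ 2 / 2)) (Ioi 0) := by
  refine (Real.GammaIntegral_convergent hs).mono' (by fun_prop) ?_
  filter_upwards [ae_restrict_mem measurableSet_Ioi] with u hu
  have hu : 0 < u := hu
  rw [norm_of_nonneg (by positivity), mul_comm]
  gcongr
  nlinarith [sq_nonneg u]

lemma integral_rpow_mul_exp_neg_sub_sq_pos {s : ℝ} (hs : 0 < s) :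
    0 < ∫ u in Ioi (0 : ℝ), u ^ (s - 1) * exp (-u - u ^ 2 / 2) := by
  rw [setIntegral_pos_iff_support_of_nonneg_ae _ (integrableOn_rpow_mul_exp_neg_sub_sq hs)]
  · have : Ioi (0 : ℝ) ⊆
        Function.support (fun u : ℝ => u ^ (s - 1) * exp (-u - u ^ 2 / 2)) := by
      intro u hu
      have hu : 0 < u := hu
      exact (by positivity : 0 < u ^ (s - 1) * exp (-u - u ^ 2 / 2)).ne'
    rw [inter_eq_right.mpr this]
    simp
  · filter_upwards [ae_restrict_mem measurableSet_Ioi] with u hu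
    have hu : 0 < u := hu
    simp only [Pi.zero_apply]
    positivity

/-- The rescaled Mellin integrand of the square-root-boundary kernel. -/
lemma rpow_mul_sqrt_kernel_eq (s : ℝ) {t : ℝ} (ht : 0 < t) {a : ℝ} (ha : 0 < a) :
    a ^ (s - 1) * exp (-a * √t - a ^ 2 * t / 2) =
      t ^ ((1 - s) / 2) * ((√t * a) ^ (s - 1) * exp (-(√t * a) - (√t * a) ^ 2 / 2)) := by
  have h1 : (√t * a) ^ (s - 1) = t ^ ((s - 1) / 2) * a ^ (s - 1) := by
    rw [mul_rpow (by positivity) ha.le, sqrt_eq_rpow, ← rpow_mul ht.le]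
    ring_nf
  have h2 : t ^ ((1 - s) / 2) * t ^ ((s - 1) / 2) = 1 := by
    rw [← rpow_add ht]
    ring_nf
    simp
  rw [h1, mul_pow, sq_sqrt ht.le, ← mul_assoc, ← mul_assoc, h2, one_mul]
  ring_nf

lemma integrableOn_rpow_mul_sqrt_kernel {s t : ℝ} (hs : 0 < s) (ht : 0 < t) :
    IntegrableOn (fun a : ℝ => a ^ (s - 1) * exp (-a * √t - a ^ 2 * t / 2)) (Ioi 0) := by
  have hI := (integrableOn_Ioi_comp_mul_left_iff
    (fun u : ℝ => u ^ (s - 1) * exp (-u - u ^ 2 / 2)) 0 (sqrt_pos.mpr ht)).mpr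
    (by simpa using integrableOn_rpow_mul_exp_neg_sub_sq hs)
  exact IntegrableOn.congr_fun (hI.const_mul (t ^ ((1 - s) / 2)))
    (fun a ha => (rpow_mul_sqrt_kernel_eq s ht ha).symm) measurableSet_Ioi

lemma integral_rpow_mul_sqrt_kernel (s : ℝ) {t : ℝ} (ht : 0 < t) :
    ∫ a in Ioi (0 : ℝ), a ^ (s - 1) * exp (-a * √t - a ^ 2 * t / 2) =
      t ^ (-s / 2) * ∫ u in Ioi (0 : ℝ), u ^ (s - 1) * exp (-u - u ^ 2 / 2) := by
  rw [setIntegral_congr_fun measurableSet_Ioi fun a ha => rpow_mul_sqrt_kernel_eq s ht ha,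
    integral_const_mul, integral_comp_mul_left_Ioi
      (fun u : ℝ => u ^ (s - 1) * exp (-u - u ^ 2 / 2)) 0 (sqrt_pos.mpr ht),
    mul_zero, smul_eq_mul, ← mul_assoc, sqrt_eq_rpow, ← rpow_neg ht.le, ← rpow_add ht]
  ring_nf

/-- The Mellin transform of the vanishing square-root-boundary transform. -/
lemma integral_rpow_mul_eq_zero_of_sqrt_transform {s : ℝ} (hs : 0 < s) {z : ℝ → ℝ}
    (hzmeas : Measurable z) (hz : IntegrableOn (fun t => t ^ (-s / 2) * |z t|) (Ioi 0))
    (h : ∀ a > (0 : ℝ), ∫ t in Ioi (0 : ℝ), exp (-a * √t - a ^ 2 * t / 2) * z t = 0) :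
    ∫ t in Ioi (0 : ℝ), t ^ (-s / 2) * z t = 0 := by
  set C := ∫ u in Ioi (0 : ℝ), u ^ (s - 1) * exp (-u - u ^ 2 / 2)
  have hCpos : 0 < C := integral_rpow_mul_exp_neg_sub_sq_pos hs
  set F : ℝ → ℝ → ℝ := fun t a => a ^ (s - 1) * exp (-a * √t - a ^ 2 * t / 2) * z t with hF
  have hFint : Integrable (Function.uncurry F)
      ((volume.restrict (Ioi (0 : ℝ))).prod (volume.restrict (Ioi (0 : ℝ)))) := by
    rw [integrable_prod_iff
      (by simp only [hF, Function.uncurry_def]; exact Measurable.aestronglyMeasurable (by fun_prop))]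
    constructor
    · filter_upwards [ae_restrict_mem measurableSet_Ioi] with t ht
      exact (integrableOn_rpow_mul_sqrt_kernel hs ht).mul_const (z t)
    · refine (hz.mul_const C).congr ?_
      filter_upwards [ae_restrict_mem measurableSet_Ioi] with t ht
      have hn : ∀ a ∈ Ioi (0 : ℝ), ‖Function.uncurry F (t, a)‖ =
          a ^ (s - 1) * exp (-a * √t - a ^ 2 * t / 2) * |z t| := by
        intro a ha
        have ha : 0 < a := ha
        rw [Function.uncurry_apply_pair, hF, norm_mul, norm_of_nonneg (by positivity),
          norm_eq_abs]
      rw [setIntegral_congr_fun measurableSet_Ioi hn, integral_mul_const,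
        integral_rpow_mul_sqrt_kernel s ht]
      ring
  have hswap := integral_integral_swap hFint
  have hright : ∫ a in Ioi (0 : ℝ), ∫ t in Ioi (0 : ℝ), F t a = 0 := by
    refine setIntegral_eq_zero_of_forall_eq_zero fun a ha => ?_
    simp only [hF, mul_assoc]
    rw [integral_const_mul, h a ha, mul_zero]
  have hleft : ∫ t in Ioi (0 : ℝ), ∫ a in Ioi (0 : ℝ), F t a =
      (∫ t in Ioi (0 : ℝ), t ^ (-s / 2) * z t) * C := by
    rw [← integral_mul_const]
    refine setIntegral_congr_fun measurableSet_Ioi fun t ht => ?_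
    simp only [hF]
    rw [integral_mul_const, integral_rpow_mul_sqrt_kernel s ht]
    ring
  rw [hleft, hright] at hswap
  exact (mul_eq_zero.mp hswap).resolve_right hCpos.ne'


open MeasureTheory Real Set

/-- **Injectivity of the square-root-boundary transform.** Let `p₀ > 0` and let `z` be
measurable with `∫₀^∞ t^{−p/2} |z(t)| dt < ∞` for every `p ∈ [0, p₀)`. If
`∫₀^∞ e^{−α√t − α²t/2} z(t) dt = 0` for every `α > 0`, then `z = 0` a.e. on `(0,∞)`. -/
theorem sqrt_boundary_transform_injective
    (p₀ : ℝ) (hp₀ : 0 < p₀) (z : ℝ → ℝ) (hzmeas : Measurable z)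
    (hz : ∀ p ∈ Ico (0 : ℝ) p₀, IntegrableOn (fun t => t ^ (-p / 2) * |z t|) (Ioi 0))
    (h : ∀ α > (0 : ℝ),
      ∫ t in Ioi (0 : ℝ), Real.exp (-α * Real.sqrt t - α ^ 2 * t / 2) * z t = 0) :
    ∀ᵐ t ∂(volume.restrict (Ioi (0 : ℝ))), z t = 0 := by
  have key (s : ℝ) : ∀ t ∈ Ioi (0 : ℝ), t ^ (-(p₀ / 2 + s) / 2) * z t =
      exp (s * (-log t / 2)) * (t ^ (-(p₀ / 2) / 2) * z t) := by
    intro t ht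
    have ht : 0 < t := ht
    rw [rpow_def_of_pos ht, rpow_def_of_pos ht, ← mul_assoc, ← exp_add]
    ring_nf
  have hmem {s : ℝ} (hs : s ∈ Ioo (-(p₀ / 2)) (p₀ / 2)) : p₀ / 2 + s ∈ Ioo 0 p₀ :=
    ⟨by linarith [hs.1], by linarith [hs.2]⟩
  have hw := ae_eq_zero_of_integral_exp_mul_eq_zero (μ := volume.restrict (Ioi (0 : ℝ)))
    (X := fun t => -log t / 2) (by fun_prop) (g := fun x => exp (-2 * x)) (by fun_prop)
    (by
      filter_upwards [ae_restrict_mem measurableSet_Ioi] with t ht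
      rw [show -2 * (-log t / 2) = log t by ring, exp_log ht])
    (w := fun t => t ^ (-(p₀ / 2) / 2) * z t) (by fun_prop) (r := p₀ / 2) (by positivity)
    (fun s hs => by
      refine IntegrableOn.congr_fun ?_ (key s) measurableSet_Ioi
      refine Integrable.mono (hz _ ⟨(hmem hs).1.le, (hmem hs).2⟩)
        (Measurable.aestronglyMeasurable (by fun_prop)) ?_
      filter_upwards with t
      simp)
    (fun s hs => by
      rw [← setIntegral_congr_fun measurableSet_Ioi (key s)]
      exact integral_rpow_mul_eq_zero_of_sqrt_transform (hmem hs).1 hzmeas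
        (hz _ ⟨(hmem hs).1.le, (hmem hs).2⟩) h)
  filter_upwards [hw, ae_restrict_mem measurableSet_Ioi] with t ht ht0
  exact (mul_eq_zero.mp ht).resolve_left (rpow_pos_of_pos ht0 _).ne'
end
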